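/- Fix p ≥ 1 and a, b > 0, and for a real random variable Z ∈ L^p(ℙ) define ρ(Z) = inf_{ξ ∈ ℝ} ( E[ (a(Z − ξ)₊ + b(Z − ξ)₋)^p ] )^{1/p}. Then ρ is positively homogeneous, translation invariant and subadditive: ρ(λZ) = λ ρ(Z) for every λ ≥ 0, ρ(Z + c) = ρ(Z) for every constant c ∈ ℝ, and ρ(Z₁ + Z₂) ≤ ρ(Z₁) + ρ(Z₂) for all Z₁, Z₂ ∈ L^p(ℙ). -/

import Mathlib

open scoped BigOperators
open MeasureTheory

noncomputable section

/-- The deviation-type risk measure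
`ρ(Z) = inf_ξ ( E[ (a (Z-ξ)₊ + c (Z-ξ)₋)^p ] )^{1/p}`. -/
def rhoDev {Ω : Type*} [MeasurableSpace Ω] (μ : Measure Ω) (p a c : ℝ) (Z : Ω → ℝ) : ℝ :=
  ⨅ ξ : ℝ, (∫ ω, (a * max (Z ω - ξ) 0 + c * max (ξ - Z ω) 0) ^ p ∂μ) ^ (1 / p)

/-- The asymmetric loss `a x₊ + c x₋`. -/
def asymLoss (a c x : ℝ) : ℝ := a * max x 0 + c * max (-x) 0

theorem asymLoss_nonneg {a c : ℝ} (ha : 0 ≤ a) (hc : 0 ≤ c) (x : ℝ) : 0 ≤ asymLoss a c x := by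
  unfold asymLoss
  positivity

theorem asymLoss_mul {a c l : ℝ} (hl : 0 ≤ l) (x : ℝ) :
    asymLoss a c (l * x) = l * asymLoss a c x := by
  have h (y : ℝ) : max (l * y) 0 = l * max y 0 := by
    rw [mul_max_of_nonneg _ _ hl, mul_zero]
  rw [asymLoss, asymLoss, ← mul_neg, h, h]
  ring

theorem asymLoss_add_le {a c : ℝ} (ha : 0 ≤ a) (hc : 0 ≤ c) (x y : ℝ) :
    asymLoss a c (x + y) ≤ asymLoss a c x + asymLoss a c y := by
  have h (u v : ℝ) : max (u + v) 0 ≤ max u 0 + max v 0 :=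
    max_le (add_le_add (le_max_left _ _) (le_max_left _ _)) (by positivity)
  have h₁ := mul_le_mul_of_nonneg_left (h x y) ha
  have h₂ := mul_le_mul_of_nonneg_left (h (-x) (-y)) hc
  rw [← neg_add] at h₂
  unfold asymLoss
  linarith

theorem asymLoss_le {a c : ℝ} (ha : 0 ≤ a) (hc : 0 ≤ c) (x : ℝ) :
    asymLoss a c x ≤ (a + c) * |x| := by
  have h₁ := mul_le_mul_of_nonneg_left (max_le (le_abs_self x) (abs_nonneg x)) ha
  have h₂ := mul_le_mul_of_nonneg_left (max_le (neg_le_abs x) (abs_nonneg x)) hc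
  unfold asymLoss
  linarith

theorem measurable_asymLoss (a c : ℝ) : Measurable (asymLoss a c) := by
  unfold asymLoss
  fun_prop

section

variable {Ω : Type*} [MeasurableSpace Ω] {μ : Measure Ω} {p a c : ℝ} {Z : Ω → ℝ}

theorem memLp_of_integrable_abs_rpow (hp : 0 < p) (hZ : Measurable Z)
    (hi : Integrable (fun ω => |Z ω| ^ p) μ) : MemLp Z (ENNReal.ofReal p) μ := by
  rw [← integrable_norm_rpow_iff hZ.aestronglyMeasurable (by simpa using hp) ENNReal.ofReal_ne_top,
    ENNReal.toReal_ofReal hp.le]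
  exact hi

theorem MeasureTheory.MemLp.asymLoss {q : ENNReal} (ha : 0 ≤ a) (hc : 0 ≤ c) (hZ : MemLp Z q μ) :
    MemLp (fun ω => asymLoss a c (Z ω)) q μ := by
  refine hZ.of_le_mul (c := a + c)
    ((measurable_asymLoss a c).comp_aemeasurable hZ.aemeasurable).aestronglyMeasurable
    (Filter.Eventually.of_forall fun ω => ?_)
  rw [Real.norm_of_nonneg (asymLoss_nonneg ha hc _)]
  exact asymLoss_le ha hc _

theorem rhoDev_eq_iInf_lpNorm (hp : 0 < p) (ha : 0 ≤ a) (hc : 0 ≤ c) (hZ : Measurable Z) :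
    rhoDev μ p a c Z =
      ⨅ ξ : ℝ, lpNorm (fun ω => asymLoss a c (Z ω - ξ)) (ENNReal.ofReal p) μ := by
  refine iInf_congr fun ξ => ?_
  have hL : Measurable fun ω => asymLoss a c (Z ω - ξ) :=
    (measurable_asymLoss a c).comp (hZ.sub_const ξ)
  rw [lpNorm_eq_integral_norm_rpow_toReal (by simpa using hp) ENNReal.ofReal_ne_top
    hL.aestronglyMeasurable, ENNReal.toReal_ofReal hp.le, one_div]
  simp_rw [Real.norm_of_nonneg (asymLoss_nonneg ha hc _), asymLoss, neg_sub]

theorem bddBelow_range_lpNorm {ι : Type*} (f : ι → Ω → ℝ) (q : ENNReal) :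
    BddBelow (Set.range fun i => lpNorm (f i) q μ) :=
  ⟨0, Set.forall_mem_range.2 fun _ => lpNorm_nonneg⟩

theorem rhoDev_add_const (t : ℝ) : rhoDev μ p a c (fun ω => Z ω + t) = rhoDev μ p a c Z := by
  unfold rhoDev
  refine (Equiv.subRight t).iInf_congr fun ξ => ?_
  have h₁ (ω : Ω) : Z ω - (ξ - t) = Z ω + t - ξ := by ring
  have h₂ (ω : Ω) : ξ - t - Z ω = ξ - (Z ω + t) := by ring
  simp only [Equiv.subRight_apply, h₁, h₂]

theorem rhoDev_zero (hp : 0 < p) (ha : 0 ≤ a) (hc : 0 ≤ c) :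
    rhoDev μ p a c (fun _ => 0) = 0 := by
  rw [rhoDev_eq_iInf_lpNorm hp ha hc measurable_const]
  refine le_antisymm ((ciInf_le (bddBelow_range_lpNorm _ _) 0).trans_eq ?_)
    (Real.iInf_nonneg fun _ => lpNorm_nonneg)
  simp [asymLoss]

theorem rhoDev_const_mul (hp : 0 < p) (ha : 0 ≤ a) (hc : 0 ≤ c) (hZ : Measurable Z) {l : ℝ}
    (hl : 0 ≤ l) : rhoDev μ p a c (fun ω => l * Z ω) = l * rhoDev μ p a c Z := by
  rcases hl.eq_or_lt with rfl | hl'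
  · simp [rhoDev_zero hp ha hc]
  rw [rhoDev_eq_iInf_lpNorm hp ha hc (hZ.const_mul l), rhoDev_eq_iInf_lpNorm hp ha hc hZ,
    Real.mul_iInf_of_nonneg hl]
  refine ((Equiv.mulLeft₀ l hl'.ne').iInf_congr fun ξ => ?_).symm
  have h := lpNorm_const_smul (p := ENNReal.ofReal p) l (fun ω => asymLoss a c (Z ω - ξ)) μ
  rw [coe_nnnorm, Real.norm_of_nonneg hl] at h
  rw [← h]
  congr 1
  ext ω
  simp [← asymLoss_mul hl, mul_sub]

theorem rhoDev_add_le [IsFiniteMeasure μ] (hp : 1 ≤ p) (ha : 0 ≤ a) (hc : 0 ≤ c) {Z₁ Z₂ : Ω → ℝ}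
    (hm₁ : Measurable Z₁) (hm₂ : Measurable Z₂) (h₁ : MemLp Z₁ (ENNReal.ofReal p) μ)
    (h₂ : MemLp Z₂ (ENNReal.ofReal p) μ) :
    rhoDev μ p a c (fun ω => Z₁ ω + Z₂ ω) ≤ rhoDev μ p a c Z₁ + rhoDev μ p a c Z₂ := by
  have hp₀ : 0 < p := one_pos.trans_le hp
  rw [rhoDev_eq_iInf_lpNorm hp₀ ha hc (hm₁.fun_add hm₂), rhoDev_eq_iInf_lpNorm hp₀ ha hc hm₁,
    rhoDev_eq_iInf_lpNorm hp₀ ha hc hm₂]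
  refine le_ciInf_add_ciInf fun ξ η => (ciInf_le (bddBelow_range_lpNorm _ _) (ξ + η)).trans ?_
  have hL₁ := (h₁.sub (memLp_const ξ)).asymLoss ha hc
  have hL₂ := (h₂.sub (memLp_const η)).asymLoss ha hc
  refine (lpNorm_mono_real (hL₁.add hL₂) fun ω => ?_).trans
    (lpNorm_add_le hL₁ (by simpa using hp))
  rw [Real.norm_of_nonneg (asymLoss_nonneg ha hc _), add_sub_add_comm]
  exact asymLoss_add_le ha hc _ _

end

/-- For `p ≥ 1` and `a, c > 0`, the deviation-type risk measure `ρ` is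
positively homogeneous, translation invariant, and subadditive on `L^p(ℙ)`. -/
theorem rhoDev_is_deviation_RB_compatible
    {Ω : Type*} [MeasurableSpace Ω] (μ : Measure Ω) [IsProbabilityMeasure μ]
    (p a c : ℝ) (hp : 1 ≤ p) (ha : 0 < a) (hc : 0 < c) :
    (∀ Z : Ω → ℝ, Measurable Z → Integrable (fun ω => |Z ω| ^ p) μ →
      (∀ lam : ℝ, 0 ≤ lam →
        rhoDev μ p a c (fun ω => lam * Z ω) = lam * rhoDev μ p a c Z) ∧
      (∀ t : ℝ, rhoDev μ p a c (fun ω => Z ω + t) = rhoDev μ p a c Z)) ∧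
    (∀ Z₁ Z₂ : Ω → ℝ, Measurable Z₁ → Measurable Z₂ →
      Integrable (fun ω => |Z₁ ω| ^ p) μ → Integrable (fun ω => |Z₂ ω| ^ p) μ →
      rhoDev μ p a c (fun ω => Z₁ ω + Z₂ ω) ≤ rhoDev μ p a c Z₁ + rhoDev μ p a c Z₂) := by
  have hp₀ : 0 < p := one_pos.trans_le hp
  exact ⟨fun Z hZ _ => ⟨fun _ hl => rhoDev_const_mul hp₀ ha.le hc.le hZ hl, rhoDev_add_const⟩,
    fun Z₁ Z₂ hm₁ hm₂ h₁ h₂ => rhoDev_add_le hp ha.le hc.le hm₁ hm₂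
      (memLp_of_integrable_abs_rpow hp₀ hm₁ h₁) (memLp_of_integrable_abs_rpow hp₀ hm₂ h₂)⟩

end
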